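/- For every s > 0 and every k ≥ 1: if s ≤ ξ_{1,r} then a(s)^{l_{1k}} ≤ Σ_{σ∈Λ_{k,r}} (t_σ s_σ^r)^{s/(s+r)} ≤ a(s)^{l_{2k}}, while if s ≥ ξ_{1,r} then a(s)^{l_{2k}} ≤ Σ_{σ∈Λ_{k,r}} (t_σ s_σ^r)^{s/(s+r)} ≤ a(s)^{l_{1k}}. The same holds with b(s), p_σ and ξ_{2,r} in place of a(s), t_σ and ξ_{1,r}. -/

import Mathlib

open MeasureTheory Filter

/-- The `n`-th quantization error of order `r` of a Borel measure `P` on `ℝ^q`: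
the infimum of `(∫ d(x,α)^r dP)^{1/r}` over finite sets `α` with `1 ≤ card α ≤ n`. -/
noncomputable def quantErr {q : ℕ} (P : Measure (EuclideanSpace ℝ (Fin q)))
    (n : ℕ) (r : ℝ) : ℝ :=
  sInf ((fun α : Finset (EuclideanSpace ℝ (Fin q)) =>
      (∫ x, Metric.infDist x (α : Set (EuclideanSpace ℝ (Fin q))) ^ r ∂P) ^ (1 / r)) ''
    {α : Finset (EuclideanSpace ℝ (Fin q)) | α.Nonempty ∧ α.card ≤ n})

/-- Product of weights `g` along a word `σ` (equals `1` for the empty word). -/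
noncomputable def prodw {N : ℕ} (g : Fin N → ℝ) (σ : List (Fin N)) : ℝ := (σ.map g).prod

/-- The composition `f_{σ_1} ∘ ⋯ ∘ f_{σ_n}` along a word `σ`. -/
def wordMap {q N : ℕ} (f : Fin N → EuclideanSpace ℝ (Fin q) → EuclideanSpace ℝ (Fin q))
    (σ : List (Fin N)) : EuclideanSpace ℝ (Fin q) → EuclideanSpace ℝ (Fin q) :=
  σ.foldr (fun i g => f i ∘ g) id

/-- `h(σ) = h^{(1)}(σ) + h^{(2)}(σ)` where
`h^{(1)}(σ) = Σ_{j=0}^{|σ|-1} p0 p_{σ|_j} t_{σ^{(l)}_{-j}} s_σ^r` and `h^{(2)}(σ) = p_σ s_σ^r`. -/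
noncomputable def hfun {N : ℕ} (r p0 : ℝ) (s t p : Fin N → ℝ) (σ : List (Fin N)) : ℝ :=
  (∑ j ∈ Finset.range σ.length, p0 * prodw p (σ.take j) * prodw t (σ.drop j)) * prodw s σ ^ r
    + prodw p σ * prodw s σ ^ r

/-- `η̲_r := min_{1 ≤ i ≤ N} min{p0 t_i + p_i, t_i} · s_i^r`. -/
noncomputable def etaLow {N : ℕ} (r p0 : ℝ) (s t p : Fin N → ℝ) : ℝ :=
  ⨅ i, min (p0 * t i + p i) (t i) * s i ^ r

/-- The finite maximal antichain `Λ_{k,r} = {σ : h(σ|_{|σ|-1}) ≥ η̲_r/k > h(σ)}`. -/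
def Lam {N : ℕ} (r p0 : ℝ) (s t p : Fin N → ℝ) (k : ℕ) : Set (List (Fin N)) :=
  {σ | σ ≠ [] ∧ etaLow r p0 s t p / k ≤ hfun r p0 s t p σ.dropLast ∧
    hfun r p0 s t p σ < etaLow r p0 s t p / k}

/-- `a(x) = Σ_i (t_i s_i^r)^{x/(x+r)}` (also used for `b` with `p` in place of `t`). -/
noncomputable def afun {N : ℕ} (r : ℝ) (s t : Fin N → ℝ) (x : ℝ) : ℝ :=
  ∑ i, (t i * s i ^ r) ^ (x / (x + r))

theorem prodw_nil {N : ℕ} (g : Fin N → ℝ) : prodw g [] = 1 := by simp [prodw]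

theorem prodw_append_singleton {N : ℕ} (g : Fin N → ℝ) (σ : List (Fin N)) (i : Fin N) :
    prodw g (σ ++ [i]) = prodw g σ * g i := by simp [prodw]

theorem prodw_pos {N : ℕ} {g : Fin N → ℝ} (hg : ∀ i, 0 < g i) (σ : List (Fin N)) :
    0 < prodw g σ := by
  induction σ using List.reverseRecOn with
  | nil => simp [prodw_nil]
  | append_singleton σ i ih => rw [prodw_append_singleton]; exact mul_pos ih (hg i)

theorem prodw_div_const {N : ℕ} (g : Fin N → ℝ) (a : ℝ) (σ : List (Fin N)) :
    prodw (fun i => g i / a) σ = prodw g σ / a ^ σ.length := by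
  induction σ using List.reverseRecOn with
  | nil => simp [prodw_nil]
  | append_singleton σ i ih =>
    simp only [prodw_append_singleton, ih, List.length_append, List.length_singleton, pow_succ]
    rw [div_mul_div_comm]

theorem prodw_mul_rpow {N : ℕ} {s u : Fin N → ℝ} (hs : ∀ i, 0 < s i) (hu : ∀ i, 0 < u i)
    (r y : ℝ) (σ : List (Fin N)) :
    (prodw u σ * prodw s σ ^ r) ^ y = prodw (fun i => (u i * s i ^ r) ^ y) σ := by
  induction σ using List.reverseRecOn with
  | nil => simp [prodw_nil]
  | append_singleton σ i ih =>
    have h1 := prodw_pos hs σ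
    have h2 := prodw_pos hu σ
    have h3 := hs i
    have h4 := hu i
    rw [prodw_append_singleton, prodw_append_singleton, prodw_append_singleton, ← ih,
      ← Real.mul_rpow (by positivity) (by positivity), Real.mul_rpow h1.le h3.le]
    congr 1
    ring

/-- The words of a finite set of words extended by one letter that leave the set. -/
def wordBoundary {N : ℕ} (S : Finset (List (Fin N))) : Finset (List (Fin N)) :=
  (S ×ˢ Finset.univ).image (fun q : List (Fin N) × Fin N => q.1 ++ [q.2]) \ S

theorem mem_wordBoundary {N : ℕ} {S : Finset (List (Fin N))} {σ : List (Fin N)} :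
    σ ∈ wordBoundary S ↔ σ ≠ [] ∧ σ.dropLast ∈ S ∧ σ ∉ S := by
  simp only [wordBoundary, Finset.mem_sdiff, Finset.mem_image, Finset.mem_product,
    Finset.mem_univ, and_true, Prod.exists]
  constructor
  · rintro ⟨⟨τ, i, hτ, rfl⟩, h⟩
    simpa [hτ] using h
  · rintro ⟨h0, h1, h2⟩
    exact ⟨⟨_, _, h1, List.dropLast_append_getLast h0⟩, h2⟩

/-- A probability vector induces a total mass of one on the boundary of a finite tree of words. -/
theorem sum_wordBoundary_prodw {N : ℕ} (w : Fin N → ℝ) (hw : ∑ i, w i = 1)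
    (S : Finset (List (Fin N))) (h0 : [] ∈ S) (hS : ∀ σ i, σ ++ [i] ∈ S → σ ∈ S) :
    ∑ σ ∈ wordBoundary S, prodw w σ = 1 := by
  set E := (S ×ˢ Finset.univ).image (fun q : List (Fin N) × Fin N => q.1 ++ [q.2]) with hE
  have hsum : ∑ σ ∈ E, prodw w σ = ∑ σ ∈ S, prodw w σ := by
    rw [hE, Finset.sum_image, Finset.sum_product]
    · refine Finset.sum_congr rfl fun σ _ => ?_
      simp only [prodw_append_singleton]
      rw [← Finset.mul_sum, hw, mul_one]
    · rintro ⟨σ, i⟩ _ ⟨τ, j⟩ _ h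
      simpa using h
  have hinter : E ∩ S = S.erase [] := by
    ext σ
    simp only [hE, Finset.mem_inter, Finset.mem_image, Finset.mem_product, Finset.mem_univ,
      and_true, Prod.exists, Finset.mem_erase]
    constructor
    · rintro ⟨⟨τ, i, _, rfl⟩, h⟩
      exact ⟨by simp, h⟩
    · rintro ⟨hne, h⟩
      have hσ := List.dropLast_append_getLast hne
      exact ⟨⟨_, _, hS σ.dropLast (σ.getLast hne) (by rwa [hσ]), hσ⟩, h⟩
  have h1 := Finset.sum_inter_add_sum_sdiff E S (prodw w)
  have h2 := Finset.add_sum_erase S (prodw w) h0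
  rw [hinter, hsum] at h1
  rw [prodw_nil] at h2
  change ∑ σ ∈ E \ S, prodw w σ = 1
  linarith

/-- The total weight of the boundary of a finite tree of words lies between the powers of the
weight of one generation taken at the extreme word lengths. -/
theorem sum_wordBoundary_prodw_bounds {N : ℕ} (w : Fin N → ℝ) (hw : ∀ i, 0 < w i) {a : ℝ}
    (ha : 0 < a) (hwa : ∑ i, w i = a)
    (S : Finset (List (Fin N))) (h0 : [] ∈ S) (hS : ∀ σ i, σ ++ [i] ∈ S → σ ∈ S) :
    (1 ≤ a →
      a ^ sInf (List.length '' (wordBoundary S : Set (List (Fin N))))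
          ≤ ∑ σ ∈ wordBoundary S, prodw w σ ∧
      ∑ σ ∈ wordBoundary S, prodw w σ
          ≤ a ^ sSup (List.length '' (wordBoundary S : Set (List (Fin N))))) ∧
    (a ≤ 1 →
      a ^ sSup (List.length '' (wordBoundary S : Set (List (Fin N))))
          ≤ ∑ σ ∈ wordBoundary S, prodw w σ ∧
      ∑ σ ∈ wordBoundary S, prodw w σ
          ≤ a ^ sInf (List.length '' (wordBoundary S : Set (List (Fin N))))) := by
  have hone := sum_wordBoundary_prodw (fun i => w i / a)
    (by rw [← Finset.sum_div, hwa, div_self ha.ne']) S h0 hS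
  have hdecomp : ∑ σ ∈ wordBoundary S, prodw w σ
      = ∑ σ ∈ wordBoundary S, a ^ σ.length * prodw (fun i => w i / a) σ := by
    refine Finset.sum_congr rfl fun σ _ => ?_
    rw [prodw_div_const, mul_div_cancel₀ _ (pow_ne_zero _ ha.ne')]
  have hnonneg : ∀ σ, 0 ≤ prodw (fun i => w i / a) σ := fun σ =>
    (prodw_pos (fun i => div_pos (hw i) ha) σ).le
  have hinf : ∀ σ ∈ wordBoundary S,
      sInf (List.length '' (wordBoundary S : Set (List (Fin N)))) ≤ σ.length := fun σ hσ =>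
    Nat.sInf_le ⟨σ, hσ, rfl⟩
  have hsup : ∀ σ ∈ wordBoundary S,
      σ.length ≤ sSup (List.length '' (wordBoundary S : Set (List (Fin N)))) := fun σ hσ =>
    le_csSup ((wordBoundary S).finite_toSet.image _).bddAbove ⟨σ, hσ, rfl⟩
  have lower : ∀ n : ℕ, (∀ σ ∈ wordBoundary S, a ^ n ≤ a ^ σ.length) →
      a ^ n ≤ ∑ σ ∈ wordBoundary S, prodw w σ := fun n h => by
    rw [hdecomp, ← mul_one (a ^ n), ← hone, Finset.mul_sum]
    exact Finset.sum_le_sum fun σ hσ => mul_le_mul_of_nonneg_right (h σ hσ) (hnonneg σ)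
  have upper : ∀ n : ℕ, (∀ σ ∈ wordBoundary S, a ^ σ.length ≤ a ^ n) →
      ∑ σ ∈ wordBoundary S, prodw w σ ≤ a ^ n := fun n h => by
    rw [hdecomp, ← mul_one (a ^ n), ← hone, Finset.mul_sum]
    exact Finset.sum_le_sum fun σ hσ => mul_le_mul_of_nonneg_right (h σ hσ) (hnonneg σ)
  exact ⟨fun h1 => ⟨lower _ fun σ hσ => pow_le_pow_right₀ h1 (hinf σ hσ),
      upper _ fun σ hσ => pow_le_pow_right₀ h1 (hsup σ hσ)⟩,
    fun h1 => ⟨lower _ fun σ hσ => pow_le_pow_of_le_one ha.le h1 (hsup σ hσ),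
      upper _ fun σ hσ => pow_le_pow_of_le_one ha.le h1 (hinf σ hσ)⟩⟩

theorem hfun_nil {N : ℕ} (r p0 : ℝ) (s t p : Fin N → ℝ) : hfun r p0 s t p [] = 1 := by
  simp [hfun, prodw_nil]

theorem hfun_append_singleton {N : ℕ} {r p0 : ℝ} {s : Fin N → ℝ} (t p : Fin N → ℝ)
    (hs : ∀ i, 0 < s i) (σ : List (Fin N)) (i : Fin N) :
    hfun r p0 s t p (σ ++ [i]) =
      s i ^ r * (t i * ((∑ j ∈ Finset.range σ.length,
          p0 * prodw p (σ.take j) * prodw t (σ.drop j)) * prodw s σ ^ r)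
        + (p0 * t i + p i) * (prodw p σ * prodw s σ ^ r)) := by
  have hsum : ∑ j ∈ Finset.range σ.length,
      p0 * prodw p ((σ ++ [i]).take j) * prodw t ((σ ++ [i]).drop j)
      = t i * ∑ j ∈ Finset.range σ.length, p0 * prodw p (σ.take j) * prodw t (σ.drop j) := by
    rw [Finset.mul_sum]
    refine Finset.sum_congr rfl fun j hj => ?_
    have hj : j ≤ σ.length := (Finset.mem_range.1 hj).le
    rw [List.take_append_of_le_length hj, List.drop_append_of_le_length hj,
      prodw_append_singleton]
    ring
  have hlast : prodw t [i] = t i := by simp [prodw]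
  rw [hfun, List.length_append, List.length_singleton, Finset.sum_range_succ, hsum,
    List.take_left, List.drop_left, hlast, prodw_append_singleton, prodw_append_singleton,
    Real.mul_rpow (prodw_pos hs σ).le (hs i).le]
  ring

theorem hfun_pos {N : ℕ} {r p0 : ℝ} {s t p : Fin N → ℝ} (hs : ∀ i, 0 < s i)
    (ht : ∀ i, 0 < t i) (hp : ∀ i, 0 < p i) (hp0 : 0 < p0) (σ : List (Fin N)) :
    0 < hfun r p0 s t p σ := by
  have h1 := prodw_pos hs σ
  have h2 := prodw_pos hp σ
  refine add_pos_of_nonneg_of_pos (mul_nonneg (Finset.sum_nonneg fun j _ => ?_) ?_) (by positivity)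
  · have h3 := prodw_pos hp (σ.take j)
    have h4 := prodw_pos ht (σ.drop j)
    positivity
  · positivity

theorem hfun_append_singleton_le {N : ℕ} {r p0 c : ℝ} {s t p : Fin N → ℝ} (hr : 0 ≤ r)
    (hs : ∀ i, s i ∈ Set.Ioo (0 : ℝ) 1) (ht : ∀ i, 0 < t i) (hp : ∀ i, 0 < p i) (hp0 : 0 < p0)
    (hct : ∀ i, t i ≤ c) (hcp : ∀ i, p0 * t i + p i ≤ c) (σ : List (Fin N)) (i : Fin N) :
    hfun r p0 s t p (σ ++ [i]) ≤ c * hfun r p0 s t p σ := by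
  have hs0 : ∀ i, 0 < s i := fun i => (hs i).1
  have h1 := prodw_pos hs0 σ
  have h2 := prodw_pos hp σ
  have hA : 0 ≤ (∑ j ∈ Finset.range σ.length,
      p0 * prodw p (σ.take j) * prodw t (σ.drop j)) * prodw s σ ^ r := by
    refine mul_nonneg (Finset.sum_nonneg fun j _ => ?_) (by positivity)
    have h3 := prodw_pos hp (σ.take j)
    have h4 := prodw_pos ht (σ.drop j)
    positivity
  have hB : 0 ≤ prodw p σ * prodw s σ ^ r := by positivity
  have hsr : s i ^ r ≤ 1 := Real.rpow_le_one (hs i).1.le (hs i).2.le hr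
  have ht' := ht i
  have hp' := hp i
  rw [hfun_append_singleton t p hs0]
  refine (mul_le_of_le_one_left (by positivity) hsr).trans ?_
  rw [hfun, mul_add]
  exact add_le_add (mul_le_mul_of_nonneg_right (hct i) hA)
    (mul_le_mul_of_nonneg_right (hcp i) hB)

theorem hfun_le_pow_length {N : ℕ} {r p0 c : ℝ} {s t p : Fin N → ℝ} (hr : 0 ≤ r)
    (hs : ∀ i, s i ∈ Set.Ioo (0 : ℝ) 1) (ht : ∀ i, 0 < t i) (hp : ∀ i, 0 < p i) (hp0 : 0 < p0)
    (hc : 0 ≤ c) (hct : ∀ i, t i ≤ c) (hcp : ∀ i, p0 * t i + p i ≤ c) (σ : List (Fin N)) :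
    hfun r p0 s t p σ ≤ c ^ σ.length := by
  induction σ using List.reverseRecOn with
  | nil => simp [hfun_nil]
  | append_singleton σ i ih =>
    refine (hfun_append_singleton_le hr hs ht hp hp0 hct hcp σ i).trans ?_
    rw [List.length_append, List.length_singleton, pow_succ']
    exact mul_le_mul_of_nonneg_left ih hc

theorem finite_setOf_le_hfun {N : ℕ} {r p0 c e : ℝ} {s t p : Fin N → ℝ} (hr : 0 ≤ r)
    (hs : ∀ i, s i ∈ Set.Ioo (0 : ℝ) 1) (ht : ∀ i, 0 < t i) (hp : ∀ i, 0 < p i) (hp0 : 0 < p0)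
    (hc : 0 ≤ c) (hc1 : c < 1) (hct : ∀ i, t i ≤ c) (hcp : ∀ i, p0 * t i + p i ≤ c)
    (he : 0 < e) : {σ | e ≤ hfun r p0 s t p σ}.Finite := by
  obtain ⟨M, hM⟩ := exists_pow_lt_of_lt_one he hc1
  refine (List.finite_length_lt (Fin N) M).subset fun σ hσ => ?_
  by_contra hlen
  have hlen' : M ≤ σ.length := not_lt.1 hlen
  exact absurd (le_trans hσ ((hfun_le_pow_length hr hs ht hp hp0 hc hct hcp σ).trans
    (pow_le_pow_of_le_one hc hc1.le hlen'))) (not_le.2 hM)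

theorem etaLow_pos {N : ℕ} [NeZero N] {r p0 : ℝ} {s t p : Fin N → ℝ} (hs : ∀ i, 0 < s i)
    (ht : ∀ i, 0 < t i) (hp : ∀ i, 0 < p i) (hp0 : 0 < p0) : 0 < etaLow r p0 s t p := by
  obtain ⟨i, hi⟩ := exists_eq_ciInf_of_finite (f := fun i => min (p0 * t i + p i) (t i) * s i ^ r)
  rw [etaLow, ← hi]
  exact mul_pos (lt_min (add_pos (mul_pos hp0 (ht i)) (hp i)) (ht i))
    (Real.rpow_pos_of_pos (hs i) r)

theorem etaLow_le_one {N : ℕ} [NeZero N] {r p0 : ℝ} {s t p : Fin N → ℝ} (hr : 0 ≤ r)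
    (hs : ∀ i, s i ∈ Set.Ioo (0 : ℝ) 1) (ht1 : ∀ i, t i ≤ 1) : etaLow r p0 s t p ≤ 1 :=
  (ciInf_le (Set.finite_range _).bddBelow 0).trans <|
    mul_le_one₀ ((min_le_right _ _).trans (ht1 0)) (Real.rpow_nonneg (hs 0).1.le r)
      (Real.rpow_le_one (hs 0).1.le (hs 0).2.le hr)

/-- The set `Lam` is the boundary of a finite tree of words. -/
theorem exists_wordBoundary_eq_Lam {N : ℕ} [NeZero N] {r p0 : ℝ} {s t p : Fin N → ℝ} (hr : 0 ≤ r)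
    (hs : ∀ i, s i ∈ Set.Ioo (0 : ℝ) 1) (ht : ∀ i, 0 < t i) (ht1 : ∀ i, t i < 1)
    (hp : ∀ i, 0 < p i) (hp0 : 0 < p0) (hp1 : ∀ i, p0 + p i ≤ 1) {k : ℕ} (hk : 1 ≤ k) :
    ∃ S : Finset (List (Fin N)), [] ∈ S ∧ (∀ σ i, σ ++ [i] ∈ S → σ ∈ S) ∧
      Lam r p0 s t p k = (wordBoundary S : Set (List (Fin N))) := by
  obtain ⟨m, hm⟩ := Finite.exists_max fun i => max (t i) (p0 * t i + p i)
  set c := max (t m) (p0 * t m + p m) with hcdef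
  have hct : ∀ i, t i ≤ c := fun i => (le_max_left _ _).trans (hm i)
  have hcp : ∀ i, p0 * t i + p i ≤ c := fun i => (le_max_right _ _).trans (hm i)
  have hc : 0 ≤ c := (ht m).le.trans (hct m)
  have hc1 : c < 1 := max_lt (ht1 m) (by nlinarith [ht1 m, hp1 m])
  have hk' : (1 : ℝ) ≤ k := by exact_mod_cast hk
  have he := div_pos (etaLow_pos (r := r) (fun i => (hs i).1) ht hp hp0)
    (zero_lt_one.trans_le hk')
  have hfin := finite_setOf_le_hfun hr hs ht hp hp0 hc hc1 hct hcp he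
  refine ⟨hfin.toFinset, ?_, fun σ i h => ?_, ?_⟩
  · rw [Set.Finite.mem_toFinset, Set.mem_ofPred_eq, hfun_nil]
    exact (div_le_self (etaLow_pos (fun i => (hs i).1) ht hp hp0).le hk').trans
      (etaLow_le_one hr hs fun i => (ht1 i).le)
  · rw [Set.Finite.mem_toFinset, Set.mem_ofPred_eq] at h ⊢
    refine h.trans ((hfun_append_singleton_le hr hs ht hp hp0 hct hcp σ i).trans ?_)
    exact mul_le_of_le_one_left (hfun_pos (fun i => (hs i).1) ht hp hp0 σ).le hc1.le
  · ext σ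
    simp [mem_wordBoundary, Lam]

theorem afun_anti {N : ℕ} {r x y : ℝ} {s u : Fin N → ℝ} (hr : 0 < r)
    (hs : ∀ i, s i ∈ Set.Ioo (0 : ℝ) 1) (hu : ∀ i, 0 < u i) (hu1 : ∀ i, u i ≤ 1)
    (hx : 0 < x) (hxy : x ≤ y) : afun r s u y ≤ afun r s u x := by
  refine Finset.sum_le_sum fun i _ => ?_
  refine Real.rpow_le_rpow_of_exponent_ge (mul_pos (hu i) (Real.rpow_pos_of_pos (hs i).1 r))
    (mul_le_one₀ (hu1 i) (Real.rpow_nonneg (hs i).1.le r)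
      (Real.rpow_le_one (hs i).1.le (hs i).2.le hr.le)) ?_
  rw [div_le_div_iff₀ (by linarith) (by linarith)]
  nlinarith

theorem finsum_wordBoundary_rpow_bounds {N : ℕ} [NeZero N] {r x ξ : ℝ} {s u : Fin N → ℝ}
    (hr : 0 < r) (hs : ∀ i, s i ∈ Set.Ioo (0 : ℝ) 1) (hu : ∀ i, 0 < u i) (hu1 : ∀ i, u i ≤ 1)
    (hx : 0 < x) (hξ : 0 < ξ) (hξe : afun r s u ξ = 1)
    (S : Finset (List (Fin N))) (h0 : [] ∈ S) (hS : ∀ σ i, σ ++ [i] ∈ S → σ ∈ S)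
    {Λ : Set (List (Fin N))} (hΛ : Λ = (wordBoundary S : Set (List (Fin N)))) :
    (x ≤ ξ →
      afun r s u x ^ sInf (List.length '' Λ)
          ≤ (∑ᶠ σ ∈ Λ, (prodw u σ * prodw s σ ^ r) ^ (x / (x + r))) ∧
      (∑ᶠ σ ∈ Λ, (prodw u σ * prodw s σ ^ r) ^ (x / (x + r)))
          ≤ afun r s u x ^ sSup (List.length '' Λ)) ∧
    (ξ ≤ x →
      afun r s u x ^ sSup (List.length '' Λ)
          ≤ (∑ᶠ σ ∈ Λ, (prodw u σ * prodw s σ ^ r) ^ (x / (x + r))) ∧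
      (∑ᶠ σ ∈ Λ, (prodw u σ * prodw s σ ^ r) ^ (x / (x + r)))
          ≤ afun r s u x ^ sInf (List.length '' Λ)) := by
  have hw : ∀ i, 0 < (u i * s i ^ r) ^ (x / (x + r)) := fun i =>
    Real.rpow_pos_of_pos (mul_pos (hu i) (Real.rpow_pos_of_pos (hs i).1 r)) _
  have ha : 0 < afun r s u x := Finset.sum_pos (fun i _ => hw i) Finset.univ_nonempty
  obtain ⟨h1, h2⟩ := sum_wordBoundary_prodw_bounds _ hw ha rfl S h0 hS
  subst hΛ
  simp only [prodw_mul_rpow (fun i => (hs i).1) hu, finsum_mem_coe_finset]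
  exact ⟨fun h => h1 (hξe ▸ afun_anti hr hs hu hu1 hx h),
    fun h => h2 (hξe ▸ afun_anti hr hs hu hu1 hξ h)⟩

/-- Lemma (Zhu): with `l_{1k} = min{|σ| : σ ∈ Λ_{k,r}}` and `l_{2k} = max{|σ| : σ ∈ Λ_{k,r}}`,
for `s ≤ ξ_{1,r}` one has `a(s)^{l_{1k}} ≤ Σ_{σ∈Λ_{k,r}} (t_σ s_σ^r)^{s/(s+r)} ≤ a(s)^{l_{2k}}`,
for `s ≥ ξ_{1,r}` the reverse, and the same with `b, p_σ, ξ_{2,r}` in place of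
`a, t_σ, ξ_{1,r}`. -/
theorem sum_over_antichain_bounds
    (N : ℕ) (hN : 2 ≤ N) (r : ℝ) (hr : 0 < r)
    (s : Fin N → ℝ) (hs : ∀ i, s i ∈ Set.Ioo (0 : ℝ) 1)
    (t : Fin N → ℝ) (ht : ∀ i, 0 < t i) (ht1 : ∑ i, t i = 1)
    (p0 : ℝ) (p : Fin N → ℝ) (hp0 : 0 < p0) (hp : ∀ i, 0 < p i)
    (hp1 : p0 + ∑ i, p i = 1)
    (ξ1 ξ2 : ℝ) (hξ1 : 0 < ξ1) (hξ2 : 0 < ξ2)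
    (hξ1e : afun r s t ξ1 = 1) (hξ2e : afun r s p ξ2 = 1)
    :
    ∀ x : ℝ, 0 < x → ∀ k : ℕ, 1 ≤ k →
      (x ≤ ξ1 →
        afun r s t x ^ sInf (List.length '' Lam r p0 s t p k)
            ≤ (∑ᶠ σ ∈ Lam r p0 s t p k, (prodw t σ * prodw s σ ^ r) ^ (x / (x + r))) ∧
        (∑ᶠ σ ∈ Lam r p0 s t p k, (prodw t σ * prodw s σ ^ r) ^ (x / (x + r)))
            ≤ afun r s t x ^ sSup (List.length '' Lam r p0 s t p k)) ∧
      (ξ1 ≤ x →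
        afun r s t x ^ sSup (List.length '' Lam r p0 s t p k)
            ≤ (∑ᶠ σ ∈ Lam r p0 s t p k, (prodw t σ * prodw s σ ^ r) ^ (x / (x + r))) ∧
        (∑ᶠ σ ∈ Lam r p0 s t p k, (prodw t σ * prodw s σ ^ r) ^ (x / (x + r)))
            ≤ afun r s t x ^ sInf (List.length '' Lam r p0 s t p k)) ∧
      (x ≤ ξ2 →
        afun r s p x ^ sInf (List.length '' Lam r p0 s t p k)
            ≤ (∑ᶠ σ ∈ Lam r p0 s t p k, (prodw p σ * prodw s σ ^ r) ^ (x / (x + r))) ∧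
        (∑ᶠ σ ∈ Lam r p0 s t p k, (prodw p σ * prodw s σ ^ r) ^ (x / (x + r)))
            ≤ afun r s p x ^ sSup (List.length '' Lam r p0 s t p k)) ∧
      (ξ2 ≤ x →
        afun r s p x ^ sSup (List.length '' Lam r p0 s t p k)
            ≤ (∑ᶠ σ ∈ Lam r p0 s t p k, (prodw p σ * prodw s σ ^ r) ^ (x / (x + r))) ∧
        (∑ᶠ σ ∈ Lam r p0 s t p k, (prodw p σ * prodw s σ ^ r) ^ (x / (x + r)))
            ≤ afun r s p x ^ sInf (List.length '' Lam r p0 s t p k)) := by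
  have : NeZero N := ⟨by lia⟩
  have ht_lt : ∀ i, t i < 1 := fun i => by
    obtain ⟨j, hj⟩ : ∃ j : Fin N, j ≠ i :=
      have : Nontrivial (Fin N) := Fin.nontrivial_iff_two_le.2 hN
      exists_ne i
    have := Finset.add_le_sum (fun m _ => (ht m).le) (Finset.mem_univ i) (Finset.mem_univ j) hj.symm
    linarith [ht j]
  have hp_le : ∀ i, p0 + p i ≤ 1 := fun i => by
    have := Finset.single_le_sum (fun m _ => (hp m).le) (Finset.mem_univ i)
    linarith
  intro x hx k hk
  obtain ⟨S, h0, hS, hΛ⟩ := exists_wordBoundary_eq_Lam hr.le hs ht ht_lt hp hp0 hp_le hk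
  obtain ⟨h1, h2⟩ := finsum_wordBoundary_rpow_bounds hr hs ht (fun i => (ht_lt i).le) hx hξ1 hξ1e
    S h0 hS hΛ
  obtain ⟨h3, h4⟩ := finsum_wordBoundary_rpow_bounds hr hs hp
    (fun i => by linarith [hp_le i]) hx hξ2 hξ2e S h0 hS hΛ
  exact ⟨h1, h2, h3, h4⟩
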